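/- Consider a quitting game with set of normal players I_* = {1,…,n}, and let R̂ be the n×n matrix whose i-th column is r̂^i, the restriction of r^i to the coordinates in I_*. If R̂ is an M-matrix (a Q-matrix with exactly one positive entry in each row and each column), then every payoff vector in D̃ := conv{r^1,…,r^n} ∩ ℝ^N_{≥0} is a sunspot equilibrium payoff: for every x ∈ D̃ and every ε > 0 there exists a sunspot ε-equilibrium ξ with ‖γ(ξ) − x‖_∞ ≤ ε. -/

import Mathlib

open MeasureTheory

noncomputable section

/-- A sunspot strategy of a player: at stage `t` (0-indexed) the player has observed the
`t+1` public signals `s^1,…,s^{t+1}`, and quits with probability `ξ t (s^1,…,s^{t+1})`. -/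
abbrev SunspotStrategy := (t : ℕ) → (Fin (t + 1) → ℝ) → ℝ

/-- A sunspot strategy is valid if every stage-function is Borel measurable with values
in `[0,1]`. -/
def ValidSunspotStrategy (ξ : SunspotStrategy) : Prop :=
  ∀ t : ℕ, Measurable (ξ t) ∧ ∀ s, ξ t s ∈ Set.Icc (0 : ℝ) 1

/-- The product of `t` independent uniform measures on `[0,1]`. -/
def signalMeasure (t : ℕ) : Measure (Fin t → ℝ) :=
  Measure.pi fun _ => volume.restrict (Set.Icc 0 1)

/-- The probability that, under the sunspot strategy profile `ξ`, the game terminates at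
stage `t` (0-indexed) with quitting set `S`. -/
def sunspotTermProb {N : ℕ} (ξ : Fin N → SunspotStrategy) (t : ℕ)
    (S : Finset (Fin N)) : ℝ :=
  ∫ s : Fin (t + 1) → ℝ,
      (∏ u : Fin t, ∏ i : Fin N,
        (1 - ξ i u.1 fun k => s (Fin.castLE (Nat.succ_le_succ u.2.le) k))) *
      ((∏ i ∈ S, ξ i t s) * ∏ i ∈ Sᶜ, (1 - ξ i t s)) ∂(signalMeasure (t + 1))

/-- The collection of nonempty subsets of players. -/
def nonempties (N : ℕ) : Finset (Finset (Fin N)) :=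
  Finset.univ.filter fun S => S ≠ ∅

/-- The expected payoff of player `i` under the sunspot strategy profile `ξ` in the
quitting game with payoffs `r`. -/
def sunspotPayoff {N : ℕ} (r : Finset (Fin N) → Fin N → ℝ)
    (ξ : Fin N → SunspotStrategy) (i : Fin N) : ℝ :=
  (∑' t : ℕ, ∑ S ∈ nonempties N, sunspotTermProb ξ t S * r S i) +
    (1 - ∑' t : ℕ, ∑ S ∈ nonempties N, sunspotTermProb ξ t S) * r ∅ i

/-- `ξ` is a sunspot `ε`-equilibrium: it is a valid profile and no player can gain more
than `ε` by a unilateral deviation to any valid sunspot strategy. -/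
def IsSunspotEpsEquilibrium {N : ℕ} (r : Finset (Fin N) → Fin N → ℝ)
    (ξ : Fin N → SunspotStrategy) (ε : ℝ) : Prop :=
  (∀ i, ValidSunspotStrategy (ξ i)) ∧
    ∀ (i : Fin N) (ξ' : SunspotStrategy), ValidSunspotStrategy ξ' →
      sunspotPayoff r ξ i ≥ sunspotPayoff r (Function.update ξ i ξ') i - ε


/-- The decreasing sequence of sets of players `I_0 ⊇ I_1 ⊇ ⋯`:
`I_0 = I` and `I_{l+1} = {i ∈ I_l : ∃ j ∈ I_l, j ≠ i, r^j_i ≤ 0}`. -/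
def normalLevel {N : ℕ} (r : Finset (Fin N) → Fin N → ℝ) : ℕ → Set (Fin N)
  | 0 => Set.univ
  | l + 1 => {i | i ∈ normalLevel r l ∧ ∃ j ∈ normalLevel r l, j ≠ i ∧ r {j} i ≤ 0}

/-- The set `I_* = ∩_l I_l` of normal players. -/
def normalPlayers {N : ℕ} (r : Finset (Fin N) → Fin N → ℝ) : Set (Fin N) :=
  ⋂ l, normalLevel r l

/-- A solution `(w,z)` of the linear complementarity problem `LCP((r^i)_{i=1}^n, q)`,
where `r i` is the vector `r^i`: `w ∈ ℝ^n_{≥0}`, `z ∈ Δ({0,1,…,n})`,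
`w = z_0 q + ∑_i z_i r^i`, and `z_i = 0` or `w_i = 0` for every `i ∈ [n]`. -/
def IsLCPSolution (n : ℕ) (r : Fin n → Fin n → ℝ) (q w : Fin n → ℝ)
    (z : Fin (n + 1) → ℝ) : Prop :=
  (∀ i, 0 ≤ w i) ∧ (∀ i, 0 ≤ z i) ∧ (∑ i, z i = 1) ∧
    (∀ j, w j = z 0 * q j + ∑ i : Fin n, z i.succ * r i j) ∧
    (∀ i : Fin n, z i.succ = 0 ∨ w i = 0)

/-- The matrix with columns `r^1,…,r^n` is a `Q`-matrix if `LCP((r^i), q)` has a solution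
for every `q ∈ ℝ^n`. -/
def IsQMatrix (n : ℕ) (r : Fin n → Fin n → ℝ) : Prop :=
  ∀ q : Fin n → ℝ, ∃ (w : Fin n → ℝ) (z : Fin (n + 1) → ℝ), IsLCPSolution n r q w z

/-- A matrix is an `M`-matrix if it is a `Q`-matrix and in each of its rows and each of
its columns there is exactly one positive entry.  Here `r i` is the `i`-th column, so
`r j i` is the entry in row `i` and column `j`. -/
def IsMMatrix (n : ℕ) (r : Fin n → Fin n → ℝ) : Prop :=
  IsQMatrix n r ∧ (∀ i : Fin n, ∃! j : Fin n, 0 < r j i) ∧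
    (∀ j : Fin n, ∃! i : Fin n, 0 < r j i)


/-! ### Realizing a finite distribution by a uniform signal -/

lemma exists_signal_map {K : Type} [Fintype K] [MeasurableSpace K] [DiscreteMeasurableSpace K]
    (p : K → ℝ) (hp : ∀ k, 0 ≤ p k) (hs : ∑ k, p k = 1) :
    ∃ f : ℝ → K, Measurable f ∧ ∀ H : K → ℝ,
      ∫ s, H (f s) ∂((volume : Measure ℝ).restrict (Set.Icc 0 1)) = ∑ k, p k * H k := by
  classical
  have hne : Nonempty K := by
    by_contra h
    rw [not_nonempty_iff] at h
    simp at hs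
  have hs' : ∑ k, ENNReal.ofReal (p k) = 1 := by
    rw [← ENNReal.ofReal_sum_of_nonneg (fun k _ => hp k), hs, ENNReal.ofReal_one]
  obtain ⟨f, hf, hfm⟩ := MeasureTheory.Measure.exists_measurable_map_eq
    (PMF.ofFintype (fun k => ENNReal.ofReal (p k)) hs').toMeasure
  refine ⟨fun s => f (Set.projIcc 0 1 zero_le_one s), by fun_prop, fun H => ?_⟩
  have h1 := (measurePreserving_subtype_coe (μa := (volume : Measure ℝ))
    (measurableSet_Icc (a := (0:ℝ)) (b := 1)))
  rw [← h1.map_eq, integral_map (by fun_prop)]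
  · simp only [Set.projIcc_val]
    have h2 : ∫ x, H (f x) = ∫ k, H k ∂(Measure.map f volume) := by
      rw [integral_map (by fun_prop)]
      exact (measurable_of_countable H).aestronglyMeasurable
    have h3 : (Measure.comap Subtype.val volume : Measure (Set.Icc (0:ℝ) 1)) = volume := rfl
    rw [h3]
    refine h2.trans ?_
    rw [hfm, PMF.integral_eq_sum]
    simp [hp]
  · exact ((measurable_of_countable H).comp (by fun_prop)).aestronglyMeasurable

/-! ### Splitting the last signal -/

instance : IsProbabilityMeasure ((volume : Measure ℝ).restrict (Set.Icc 0 1)) :=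
  ⟨by simp⟩

instance (t : ℕ) : IsProbabilityMeasure (signalMeasure t) := by
  unfold signalMeasure; infer_instance

lemma integral_signal_succ (t : ℕ) (F : (Fin t → ℝ) → ℝ → ℝ)
    (hF : Measurable fun a : (Fin t → ℝ) × ℝ => F a.1 a.2) (C : ℝ) (hC : ∀ a b, |F a b| ≤ C) :
    ∫ s, F (Fin.init s) (s (Fin.last t)) ∂(signalMeasure (t + 1)) =
      ∫ a, ∫ b, F a b ∂((volume : Measure ℝ).restrict (Set.Icc 0 1)) ∂(signalMeasure t) := by
  have h := (measurePreserving_piFinSuccAbove (n := t) (α := fun _ => ℝ)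
    (fun _ => (volume : Measure ℝ).restrict (Set.Icc 0 1)) (Fin.last t))
  have h2 := h.integral_comp' (g := fun c : ℝ × (Fin t → ℝ) => F c.2 c.1)
  have h3 : ∀ s : Fin (t+1) → ℝ,
      (MeasurableEquiv.piFinSuccAbove (fun _ : Fin (t+1) => ℝ) (Fin.last t)) s =
      (s (Fin.last t), Fin.init s) := by
    intro s
    simp [MeasurableEquiv.piFinSuccAbove, Fin.insertNthEquiv]
  simp only [h3] at h2
  unfold signalMeasure
  rw [h2, integral_prod_symm]
  refine Integrable.of_bound (C := C) ?_ ?_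
  · exact (hF.comp measurable_swap).aestronglyMeasurable
  · exact Filter.Eventually.of_forall fun x => hC _ _

/-! ### Alive probabilities and stage payoffs -/

/-- Probability (given signals) that play has not stopped before stage `t`. -/
def aliveP {N : ℕ} (ζ : Fin N → SunspotStrategy) (t : ℕ) (s : Fin (t + 1) → ℝ) : ℝ :=
  ∏ u : Fin t, ∏ i : Fin N,
    (1 - ζ i u.1 fun k => s (Fin.castLE (Nat.succ_le_succ u.2.le) k))

/-- Probability (given signals) that nobody quits at stage `t`. -/
def contP {N : ℕ} (ζ : Fin N → SunspotStrategy) (t : ℕ) (s : Fin (t + 1) → ℝ) : ℝ :=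
  ∏ i : Fin N, (1 - ζ i t s)

/-- Probability of the quitting set `S` when player `i` quits with probability `y i`. -/
def setP {N : ℕ} (y : Fin N → ℝ) (S : Finset (Fin N)) : ℝ :=
  (∏ i ∈ S, y i) * ∏ i ∈ Sᶜ, (1 - y i)

lemma aliveP_zero {N : ℕ} (ζ : Fin N → SunspotStrategy) (s) : aliveP ζ 0 s = 1 := by
  simp [aliveP]

lemma aliveP_succ {N : ℕ} (ζ : Fin N → SunspotStrategy) (t : ℕ) (s : Fin (t + 2) → ℝ) :
    aliveP ζ (t + 1) s = aliveP ζ t (Fin.init s) * contP ζ t (Fin.init s) := by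
  unfold aliveP contP
  rw [Fin.prod_univ_castSucc]
  rfl

lemma aliveP_mem {N : ℕ} (ζ : Fin N → SunspotStrategy) (hζ : ∀ i, ValidSunspotStrategy (ζ i))
    (t : ℕ) (s) : aliveP ζ t s ∈ Set.Icc (0:ℝ) 1 := by
  constructor
  · exact Finset.prod_nonneg fun u _ => Finset.prod_nonneg fun i _ => by
      linarith [((hζ i u.1).2 (fun k => s (Fin.castLE (Nat.succ_le_succ u.2.le) k))).2]
  · refine Finset.prod_le_one (fun u _ => Finset.prod_nonneg fun i _ => ?_)
      fun u _ => Finset.prod_le_one (fun i _ => ?_) fun i _ => ?_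
    · linarith [((hζ i u.1).2 (fun k => s (Fin.castLE (Nat.succ_le_succ u.2.le) k))).2]
    · linarith [((hζ i u.1).2 (fun k => s (Fin.castLE (Nat.succ_le_succ u.2.le) k))).2]
    · linarith [((hζ i u.1).2 (fun k => s (Fin.castLE (Nat.succ_le_succ u.2.le) k))).1]

lemma contP_mem {N : ℕ} (ζ : Fin N → SunspotStrategy) (hζ : ∀ i, ValidSunspotStrategy (ζ i))
    (t : ℕ) (s) : contP ζ t s ∈ Set.Icc (0:ℝ) 1 := by
  constructor
  · exact Finset.prod_nonneg fun i _ => by linarith [((hζ i t).2 s).2]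
  · exact Finset.prod_le_one (fun i _ => by linarith [((hζ i t).2 s).2])
      fun i _ => by linarith [((hζ i t).2 s).1]

lemma setP_nonneg {N : ℕ} (y : Fin N → ℝ) (hy : ∀ i, y i ∈ Set.Icc (0:ℝ) 1) (S) :
    0 ≤ setP y S :=
  mul_nonneg (Finset.prod_nonneg fun i _ => (hy i).1)
    (Finset.prod_nonneg fun i _ => by linarith [(hy i).2])

lemma sum_setP {N : ℕ} (y : Fin N → ℝ) : ∑ S, setP y S = 1 := by
  have h := Finset.prod_add y (fun i => 1 - y i) Finset.univ
  simp only [add_sub_cancel, Finset.prod_const_one, Finset.powerset_univ] at h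
  rw [h]
  refine Finset.sum_congr rfl fun S _ => ?_
  rw [setP, Finset.compl_eq_univ_sdiff]

lemma sum_nonempties {N : ℕ} (g : Finset (Fin N) → ℝ) :
    ∑ S, g S = g ∅ + ∑ S ∈ nonempties N, g S := by
  rw [nonempties, ← Finset.sum_filter_add_sum_filter_not Finset.univ (fun S => S = ∅)]
  simp [Finset.filter_eq']

lemma sum_setP_nonempties {N : ℕ} (y : Fin N → ℝ) :
    ∑ S ∈ nonempties N, setP y S = 1 - ∏ i, (1 - y i) := by
  have h := sum_setP y
  rw [sum_nonempties] at h
  simp only [setP, Finset.prod_empty, Finset.compl_empty, one_mul] at h ⊢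
  linarith

lemma measurable_aliveP {N : ℕ} (ζ : Fin N → SunspotStrategy)
    (hζ : ∀ i, ValidSunspotStrategy (ζ i)) (t : ℕ) : Measurable (aliveP ζ t) := by
  unfold aliveP
  refine Finset.measurable_prod _ fun u _ => Finset.measurable_prod _ fun i _ => ?_
  exact measurable_const.sub ((hζ i u.1).1.comp (by fun_prop))

lemma measurable_contP {N : ℕ} (ζ : Fin N → SunspotStrategy)
    (hζ : ∀ i, ValidSunspotStrategy (ζ i)) (t : ℕ) : Measurable (contP ζ t) := by
  unfold contP
  exact Finset.measurable_prod _ fun i _ => measurable_const.sub (hζ i t).1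

lemma measurable_setP {N : ℕ} (ζ : Fin N → SunspotStrategy)
    (hζ : ∀ i, ValidSunspotStrategy (ζ i)) (t : ℕ) (S) :
    Measurable (fun s => setP (fun i => ζ i t s) S) := by
  unfold setP
  exact (Finset.measurable_prod _ fun i _ => (hζ i t).1).mul
    (Finset.measurable_prod _ fun i _ => measurable_const.sub (hζ i t).1)

lemma setP_le_one {N : ℕ} (y : Fin N → ℝ) (hy : ∀ i, y i ∈ Set.Icc (0:ℝ) 1) (S) :
    setP y S ≤ 1 := by
  rw [← sum_setP y]
  exact Finset.single_le_sum (f := setP y) (fun S _ => setP_nonneg y hy S) (Finset.mem_univ S)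

lemma integrable_signal {t : ℕ} (F : (Fin t → ℝ) → ℝ) (hF : Measurable F) (C : ℝ)
    (hC : ∀ s, |F s| ≤ C) : Integrable F (signalMeasure t) :=
  Integrable.of_bound (C := C) hF.aestronglyMeasurable (Filter.Eventually.of_forall hC)

/-- Expected stage payoff. -/
def stageG {N : ℕ} (ζ : Fin N → SunspotStrategy) (ρ : Finset (Fin N) → ℝ) (t : ℕ) : ℝ :=
  ∑ S ∈ nonempties N, sunspotTermProb ζ t S * ρ S

/-- Probability of being alive at stage `t`. -/
def aliveE {N : ℕ} (ζ : Fin N → SunspotStrategy) (t : ℕ) : ℝ :=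
  ∫ s, aliveP ζ t s ∂(signalMeasure (t + 1))

lemma termProb_eq {N : ℕ} (ζ : Fin N → SunspotStrategy) (t : ℕ) (S) :
    sunspotTermProb ζ t S =
      ∫ s, aliveP ζ t s * setP (fun i => ζ i t s) S ∂(signalMeasure (t + 1)) := rfl


lemma integrable_term {N : ℕ} (ζ : Fin N → SunspotStrategy)
    (hζ : ∀ i, ValidSunspotStrategy (ζ i)) (t : ℕ) (S) : Integrable
    (fun s => aliveP ζ t s * setP (fun i => ζ i t s) S) (signalMeasure (t + 1)) := by
  refine integrable_signal _ ((measurable_aliveP ζ hζ t).mul (measurable_setP ζ hζ t S)) 1 ?_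
  intro s
  have h1 := aliveP_mem ζ hζ t s
  have hy : ∀ i, ζ i t s ∈ Set.Icc (0:ℝ) 1 := fun i => (hζ i t).2 s
  have h2 := setP_nonneg _ hy S
  have h3 := setP_le_one _ hy S
  rw [abs_of_nonneg (mul_nonneg h1.1 h2)]
  exact mul_le_one₀ h1.2 h2 h3

lemma termProb_nonneg {N : ℕ} (ζ : Fin N → SunspotStrategy)
    (hζ : ∀ i, ValidSunspotStrategy (ζ i)) (t : ℕ) (S) : 0 ≤ sunspotTermProb ζ t S := by
  rw [termProb_eq]
  exact integral_nonneg fun s => mul_nonneg (aliveP_mem ζ hζ t s).1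
    (setP_nonneg _ (fun i => (hζ i t).2 s) S)

lemma stageG_eq {N : ℕ} (ζ : Fin N → SunspotStrategy)
    (hζ : ∀ i, ValidSunspotStrategy (ζ i)) (ρ : Finset (Fin N) → ℝ) (t : ℕ) : stageG ζ ρ t =
    ∫ s, aliveP ζ t s * ∑ S ∈ nonempties N, setP (fun i => ζ i t s) S * ρ S
      ∂(signalMeasure (t + 1)) := by
  unfold stageG
  simp_rw [Finset.mul_sum, ← mul_assoc]
  rw [integral_finsetSum _ fun S _ => (integrable_term ζ hζ t S).mul_const _]
  refine Finset.sum_congr rfl fun S _ => ?_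
  rw [integral_mul_const, termProb_eq]

lemma integral_drop_last (t : ℕ) (F : (Fin t → ℝ) → ℝ) (hF : Measurable F) (C : ℝ)
    (hC : ∀ s, |F s| ≤ C) :
    ∫ s, F (Fin.init s) ∂(signalMeasure (t + 1)) = ∫ s, F s ∂(signalMeasure t) := by
  rw [integral_signal_succ t (fun a _ => F a) (by fun_prop) C (fun a _ => hC a)]
  simp

lemma alive_cont_bound {N : ℕ} (ζ : Fin N → SunspotStrategy)
    (hζ : ∀ i, ValidSunspotStrategy (ζ i)) (t : ℕ) (s) : |aliveP ζ t s * contP ζ t s| ≤ 1 := by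
  have h1 := aliveP_mem ζ hζ t s
  have h2 := contP_mem ζ hζ t s
  rw [abs_of_nonneg (mul_nonneg h1.1 h2.1)]
  exact mul_le_one₀ h1.2 h2.1 h2.2

lemma aliveE_succ {N : ℕ} (ζ : Fin N → SunspotStrategy)
    (hζ : ∀ i, ValidSunspotStrategy (ζ i)) (t : ℕ) : aliveE ζ (t + 1) =
    ∫ s, aliveP ζ t s * contP ζ t s ∂(signalMeasure (t + 1)) := by
  unfold aliveE
  simp_rw [aliveP_succ]
  exact integral_drop_last (t + 1) (fun s => aliveP ζ t s * contP ζ t s)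
    ((measurable_aliveP ζ hζ t).mul (measurable_contP ζ hζ t)) 1 (alive_cont_bound ζ hζ t)

lemma aliveE_nonneg {N : ℕ} (ζ : Fin N → SunspotStrategy)
    (hζ : ∀ i, ValidSunspotStrategy (ζ i)) (t : ℕ) : 0 ≤ aliveE ζ t := integral_nonneg fun s => (aliveP_mem ζ hζ t s).1

lemma integrable_alive {N : ℕ} (ζ : Fin N → SunspotStrategy)
    (hζ : ∀ i, ValidSunspotStrategy (ζ i)) (t : ℕ) : Integrable (aliveP ζ t) (signalMeasure (t + 1)) := by
  refine integrable_signal _ (measurable_aliveP ζ hζ t) 1 fun s => ?_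
  have h1 := aliveP_mem ζ hζ t s
  rw [abs_of_nonneg h1.1]; exact h1.2

lemma integrable_alive_cont {N : ℕ} (ζ : Fin N → SunspotStrategy)
    (hζ : ∀ i, ValidSunspotStrategy (ζ i)) (t : ℕ) :
    Integrable (fun s => aliveP ζ t s * contP ζ t s) (signalMeasure (t + 1)) :=
  integrable_signal _ ((measurable_aliveP ζ hζ t).mul (measurable_contP ζ hζ t)) 1
    (alive_cont_bound ζ hζ t)

lemma stageG_one {N : ℕ} (ζ : Fin N → SunspotStrategy)
    (hζ : ∀ i, ValidSunspotStrategy (ζ i)) (t : ℕ) : stageG ζ (fun _ => 1) t = aliveE ζ t - aliveE ζ (t + 1) := by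
  rw [stageG_eq ζ hζ, aliveE_succ ζ hζ, aliveE,
    ← integral_sub (integrable_alive ζ hζ t) (integrable_alive_cont ζ hζ t)]
  refine integral_congr_ae (Filter.Eventually.of_forall fun s => ?_)
  simp only [mul_one]
  rw [sum_setP_nonempties, contP]
  ring

lemma hasSum_stageG_one {N : ℕ} (ζ : Fin N → SunspotStrategy)
    (hζ : ∀ i, ValidSunspotStrategy (ζ i)) (h0 : Filter.Tendsto (aliveE ζ) Filter.atTop (nhds 0)) :
    HasSum (stageG ζ (fun _ => 1)) 1 := by
  rw [hasSum_iff_tendsto_nat_of_nonneg]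
  · simp_rw [stageG_one ζ hζ]
    simp_rw [Finset.sum_range_sub']
    have : aliveE ζ 0 = 1 := by simp [aliveE, aliveP_zero]
    rw [this]
    simpa using h0.const_sub 1
  · intro t
    exact Finset.sum_nonneg fun S _ => by simpa using termProb_nonneg ζ hζ t S

lemma abs_stageG_le {N : ℕ} (ζ : Fin N → SunspotStrategy)
    (hζ : ∀ i, ValidSunspotStrategy (ζ i)) (ρ : Finset (Fin N) → ℝ) (C : ℝ) (hρ : ∀ S, |ρ S| ≤ C) (t : ℕ) :
    |stageG ζ ρ t| ≤ C * stageG ζ (fun _ => 1) t := by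
  unfold stageG
  refine (Finset.abs_sum_le_sum_abs _ _).trans ?_
  rw [Finset.mul_sum]
  refine Finset.sum_le_sum fun S _ => ?_
  rw [abs_mul, abs_of_nonneg (termProb_nonneg ζ hζ t S)]
  nlinarith [termProb_nonneg ζ hζ t S, hρ S]

lemma summable_stageG {N : ℕ} (ζ : Fin N → SunspotStrategy)
    (hζ : ∀ i, ValidSunspotStrategy (ζ i)) (h0 : Filter.Tendsto (aliveE ζ) Filter.atTop (nhds 0))
    (ρ : Finset (Fin N) → ℝ) (C : ℝ) (hρ : ∀ S, |ρ S| ≤ C) : Summable (stageG ζ ρ) :=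
  Summable.of_norm_bounded (g := fun t => C * stageG ζ (fun _ => 1) t)
    ((hasSum_stageG_one ζ hζ h0).summable.mul_left C) (abs_stageG_le ζ hζ ρ C hρ)

lemma payoff_eq {N : ℕ} (ζ : Fin N → SunspotStrategy)
    (hζ : ∀ i, ValidSunspotStrategy (ζ i)) (h0 : Filter.Tendsto (aliveE ζ) Filter.atTop (nhds 0))
    (r : Finset (Fin N) → Fin N → ℝ) (i : Fin N) :
    sunspotPayoff r ζ i = ∑' t, stageG ζ (fun S => r S i) t := by
  have h := (hasSum_stageG_one ζ hζ h0).tsum_eq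
  simp only [stageG, mul_one] at h
  rw [sunspotPayoff, h]
  simp [stageG]


/-! ### The signal-driven Markov chain -/

/-- State at stage `t` as a function of the signals seen so far. -/
def chainState {K : Type} (f0 : ℝ → K) (F : K → ℝ → K) : (t : ℕ) → (Fin (t + 1) → ℝ) → K
  | 0, s => f0 (s 0)
  | t + 1, s => F (chainState f0 F t (Fin.init s)) (s (Fin.last (t + 1)))

section
variable {K : Type} [Fintype K] [MeasurableSpace K] [DiscreteMeasurableSpace K]
  (f0 : ℝ → K) (F : K → ℝ → K) (hf0 : Measurable f0) (hF : ∀ k, Measurable (F k))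

lemma measurable_F2 (hF : ∀ k, Measurable (F k)) : Measurable fun a : K × ℝ => F a.1 a.2 :=
  measurable_from_prod_countable_right hF

lemma measurable_chainState (hf0 : Measurable f0) (hF : ∀ k, Measurable (F k)) (t : ℕ) :
    Measurable (chainState f0 F t) := by
  induction t with
  | zero => exact hf0.comp (measurable_pi_apply 0)
  | succ t ih =>
    have h1 : Measurable fun s : Fin (t + 2) → ℝ =>
        (chainState f0 F t (Fin.init s), s (Fin.last (t + 1))) := by
      refine (ih.comp ?_).prodMk (measurable_pi_apply _)
      unfold Fin.init
      fun_prop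
    exact (measurable_F2 F hF).comp h1

lemma integral_chain_succ (hf0 : Measurable f0) (hF : ∀ k, Measurable (F k))
    (P : K → K → ℝ)
    (hP : ∀ k (H : K → ℝ), ∫ s, H (F k s) ∂((volume : Measure ℝ).restrict (Set.Icc 0 1))
      = ∑ m, P k m * H m)
    (t : ℕ) (g : (Fin (t + 1) → ℝ) → ℝ) (hg : Measurable g) (C : ℝ) (hC : ∀ s, |g s| ≤ C)
    (H : K → ℝ) :
    ∫ s, g (Fin.init s) * H (chainState f0 F (t + 1) s) ∂(signalMeasure (t + 2)) =
      ∫ s, g s * ∑ m, P (chainState f0 F t s) m * H m ∂(signalMeasure (t + 1)) := by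
  have hm := measurable_chainState f0 F hf0 hF t
  have h := integral_signal_succ (t + 1)
    (fun a b => g a * H (F (chainState f0 F t a) b)) ?_ (C * ∑ k, |H k|) ?_
  · refine Eq.trans ?_ (h.trans ?_)
    · rfl
    · refine integral_congr_ae (Filter.Eventually.of_forall fun s => ?_)
      simp only
      rw [integral_const_mul, hP]
  · refine (hg.comp measurable_fst).mul ((measurable_of_countable H).comp ?_)
    exact (measurable_F2 F hF).comp ((hm.comp measurable_fst).prodMk measurable_snd)
  · intro a b
    rw [abs_mul]
    have h1 : |H (F (chainState f0 F t a) b)| ≤ ∑ k, |H k| :=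
      Finset.single_le_sum (f := fun k => |H k|) (fun k _ => abs_nonneg _) (Finset.mem_univ _)
    exact mul_le_mul (hC a) h1 (abs_nonneg _) ((abs_nonneg _).trans (hC a))

lemma drift_bound (hf0 : Measurable f0) (hF : ∀ k, Measurable (F k))
    (P : K → K → ℝ)
    (hP : ∀ k (H : K → ℝ), ∫ s, H (F k s) ∂((volume : Measure ℝ).restrict (Set.Icc 0 1))
      = ∑ m, P k m * H m)
    (p0 : K → ℝ)
    (hp0 : ∀ H : K → ℝ, ∫ s, H (f0 s) ∂((volume : Measure ℝ).restrict (Set.Icc 0 1))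
      = ∑ m, p0 m * H m)
    {N : ℕ} (ζ : Fin N → SunspotStrategy) (hζ : ∀ i, ValidSunspotStrategy (ζ i))
    (h0 : Filter.Tendsto (aliveE ζ) Filter.atTop (nhds 0))
    (ρ : Finset (Fin N) → ℝ) (C : ℝ) (hρ : ∀ S, |ρ S| ≤ C) (W : K → ℝ)
    (hd : ∀ t s, ∑ S ∈ nonempties N, setP (fun i => ζ i t s) S * ρ S +
      contP ζ t s * ∑ m, P (chainState f0 F t s) m * W m ≤ W (chainState f0 F t s)) :
    ∑' t, stageG ζ ρ t ≤ ∑ m, p0 m * W m := by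
  have hW : ∀ k, |W k| ≤ ∑ k, |W k| := fun k =>
    Finset.single_le_sum (f := fun k => |W k|) (fun k _ => abs_nonneg _) (Finset.mem_univ _)
  set CW := ∑ k, |W k| with hCW
  have hCW0 : 0 ≤ CW := Finset.sum_nonneg fun _ _ => abs_nonneg _
  set Φ : ℕ → ℝ := fun t => ∫ s, aliveP ζ t s * W (chainState f0 F t s) ∂(signalMeasure (t + 1))
    with hΦ
  have hbd : ∀ t s, |aliveP ζ t s * W (chainState f0 F t s)| ≤ CW * aliveP ζ t s := by
    intro t s
    rw [abs_mul, abs_of_nonneg (aliveP_mem ζ hζ t s).1, mul_comm]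
    exact mul_le_mul_of_nonneg_right (hW _) (aliveP_mem ζ hζ t s).1
  have hmeasW : ∀ t, Measurable fun s => aliveP ζ t s * W (chainState f0 F t s) := fun t =>
    (measurable_aliveP ζ hζ t).mul
      ((measurable_of_countable W).comp (measurable_chainState f0 F hf0 hF t))
  have hinteg : ∀ t, Integrable (fun s => aliveP ζ t s * W (chainState f0 F t s))
      (signalMeasure (t + 1)) := fun t =>
    ((integrable_alive ζ hζ t).const_mul CW).mono' (hmeasW t).aestronglyMeasurable
      (Filter.Eventually.of_forall (hbd t))
  have hΦ0 : Φ 0 = ∑ m, p0 m * W m := by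
    have h := integral_signal_succ 0 (fun _ b => W (f0 b))
      ((measurable_of_countable W).comp (hf0.comp measurable_snd)) CW (fun _ _ => hW _)
    rw [← hp0 W]
    simp only [integral_const, probReal_univ, one_smul] at h
    rw [← h]
    simp only [hΦ, aliveP_zero, one_mul]
    rfl
  have hstep : ∀ t, stageG ζ ρ t + Φ (t + 1) ≤ Φ t := by
    intro t
    have h1 : Φ (t + 1) = ∫ s, (aliveP ζ t s * contP ζ t s) *
        ∑ m, P (chainState f0 F t s) m * W m ∂(signalMeasure (t + 1)) := by
      simp only [hΦ, aliveP_succ]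
      exact integral_chain_succ f0 F hf0 hF P hP t (fun s => aliveP ζ t s * contP ζ t s)
        ((measurable_aliveP ζ hζ t).mul (measurable_contP ζ hζ t)) 1
        (alive_cont_bound ζ hζ t) W
    have hPm : ∀ k, |∑ m, P k m * W m| ≤ ∑ k, |∑ m, P k m * W m| := fun k =>
      Finset.single_le_sum (f := fun k => |∑ m, P k m * W m|)
        (fun k _ => abs_nonneg _) (Finset.mem_univ _)
    have hi1 : Integrable (fun s => aliveP ζ t s * ∑ S ∈ nonempties N,
        setP (fun i => ζ i t s) S * ρ S) (signalMeasure (t + 1)) := by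
      simp_rw [Finset.mul_sum, ← mul_assoc]
      exact integrable_finsetSum _ fun S _ => (integrable_term ζ hζ t S).mul_const _
    have hi2 : Integrable (fun s => (aliveP ζ t s * contP ζ t s) *
        ∑ m, P (chainState f0 F t s) m * W m) (signalMeasure (t + 1)) := by
      refine (integrable_alive_cont ζ hζ t).mul_bdd (c := ∑ k, |∑ m, P k m * W m|) ?_
        (Filter.Eventually.of_forall fun s => hPm _)
      exact ((measurable_of_countable fun k => ∑ m, P k m * W m).comp
        (measurable_chainState f0 F hf0 hF t)).aestronglyMeasurable
    rw [h1, stageG_eq ζ hζ, ← integral_add hi1 hi2]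
    refine integral_mono (hi1.add hi2) (hinteg t) fun s => ?_
    have := mul_le_mul_of_nonneg_left (hd t s) (aliveP_mem ζ hζ t s).1
    simp only [Pi.add_apply]
    linarith
  have hsum : ∀ T, ∑ t ∈ Finset.range T, stageG ζ ρ t ≤ Φ 0 - Φ T := by
    intro T
    induction T with
    | zero => simp
    | succ T ih => rw [Finset.sum_range_succ]; linarith [hstep T]
  have hΦlim : Filter.Tendsto Φ Filter.atTop (nhds 0) := by
    have h2 : Filter.Tendsto (fun t => CW * aliveE ζ t) Filter.atTop (nhds 0) := by
      simpa using h0.const_mul CW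
    refine squeeze_zero_norm (fun t => ?_) h2
    refine (norm_integral_le_integral_norm _).trans ?_
    rw [aliveE, ← integral_const_mul]
    exact integral_mono (hinteg t).norm ((integrable_alive ζ hζ t).const_mul CW) (hbd t)
  have hlim := (summable_stageG ζ hζ h0 ρ C hρ).hasSum.tendsto_sum_nat
  have hlim2 : Filter.Tendsto (fun T => Φ 0 - Φ T) Filter.atTop (nhds (Φ 0)) := by
    simpa using hΦlim.const_sub (Φ 0)
  rw [← hΦ0]
  exact le_of_tendsto_of_tendsto' hlim hlim2 hsum

end

/-! ### One-stage computations with at most two active players -/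

lemma stage_two {N : ℕ} (y : Fin N → ℝ) (i q : Fin N) (hiq : i ≠ q)
    (hy : ∀ j, j ≠ i → j ≠ q → y j = 0) (ρ : Finset (Fin N) → ℝ) :
    ∑ S ∈ nonempties N, setP y S * ρ S = y i * (1 - y q) * ρ {i} + y q * (1 - y i) * ρ {q} +
      y i * y q * ρ {i, q} := by
  have hsub : ({{i}, {q}, {i, q}} : Finset (Finset (Fin N))) ⊆ nonempties N := by
    intro S hS
    simp only [Finset.mem_insert, Finset.mem_singleton] at hS
    simp only [nonempties, Finset.mem_filter, Finset.mem_univ, true_and]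
    rcases hS with rfl | rfl | rfl <;> simp
  rw [← Finset.sum_subset hsub]
  · have h1 : ({i} : Finset (Fin N)) ≠ {q} := by simpa using hiq
    have h2 : ({i} : Finset (Fin N)) ≠ {i, q} := by
      intro h
      have : q ∈ ({i} : Finset (Fin N)) := by rw [h]; simp
      simp at this; exact hiq this.symm
    have h3 : ({q} : Finset (Fin N)) ≠ {i, q} := by
      intro h
      have : i ∈ ({q} : Finset (Fin N)) := by rw [h]; simp
      simp at this; exact hiq this
    have e1 : setP y {i} = y i * (1 - y q) := by
      rw [setP, Finset.prod_singleton, Finset.prod_eq_single q]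
      · intro j hj hjq
        rw [hy j (by simpa using hj) hjq, sub_zero]
      · intro h; simp at h; exact absurd h.symm hiq
    have e2 : setP y {q} = y q * (1 - y i) := by
      rw [setP, Finset.prod_singleton, Finset.prod_eq_single i]
      · intro j hj hjq
        rw [hy j hjq (by simpa using hj), sub_zero]
      · intro h; simp at h; exact absurd h hiq
    have e3 : setP y {i, q} = y i * y q := by
      rw [setP, Finset.prod_pair hiq, Finset.prod_eq_one, mul_one]
      intro j hj
      simp at hj
      rw [hy j hj.1 hj.2, sub_zero]
    rw [Finset.sum_insert (by simp [h1, h2]), Finset.sum_insert (by simp [h3]),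
      Finset.sum_singleton, e1, e2, e3]
    ring
  · intro S hS hS'
    simp only [nonempties, Finset.mem_filter, Finset.mem_univ, true_and] at hS
    have : ∃ j ∈ S, j ≠ i ∧ j ≠ q := by
      by_contra hcon
      push Not at hcon
      apply hS'
      simp only [Finset.mem_insert, Finset.mem_singleton]
      by_cases hi : i ∈ S <;> by_cases hq : q ∈ S
      · right; right; ext j; simp; grind
      · left; ext j; simp; grind
      · right; left; ext j; simp; grind
      · exfalso; apply hS; ext j; simp; grind
    obtain ⟨j, hj, hj1, hj2⟩ := this
    rw [setP, Finset.prod_eq_zero hj (hy j hj1 hj2)]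
    simp

lemma cont_two {N : ℕ} (y : Fin N → ℝ) (i q : Fin N) (hiq : i ≠ q)
    (hy : ∀ j, j ≠ i → j ≠ q → y j = 0) : ∏ j, (1 - y j) = (1 - y i) * (1 - y q) := by
  rw [← Finset.prod_pair (f := fun j => 1 - y j) hiq]
  symm
  refine Finset.prod_subset (Finset.subset_univ _) fun j _ hj => ?_
  simp at hj
  rw [hy j hj.1 hj.2, sub_zero]

lemma stage_one {N : ℕ} (y : Fin N → ℝ) (i : Fin N)
    (hy : ∀ j, j ≠ i → y j = 0) (ρ : Finset (Fin N) → ℝ) :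
    ∑ S ∈ nonempties N, setP y S * ρ S = y i * ρ {i} := by
  rw [Finset.sum_eq_single {i}]
  · rw [setP, Finset.prod_singleton, Finset.prod_eq_one, mul_one]
    intro j hj
    rw [hy j (by simpa using hj), sub_zero]
  · intro S hS hSi
    simp only [nonempties, Finset.mem_filter, Finset.mem_univ, true_and] at hS
    have : ∃ j ∈ S, j ≠ i := by
      by_contra hcon
      push Not at hcon
      obtain ⟨j, hj⟩ := Finset.nonempty_iff_ne_empty.mpr hS
      apply hSi
      ext k
      simp; grind
    obtain ⟨j, hj, hj1⟩ := this
    rw [setP, Finset.prod_eq_zero hj (hy j hj1)]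
    simp
  · intro h
    simp [nonempties] at h

lemma cont_one {N : ℕ} (y : Fin N → ℝ) (i : Fin N)
    (hy : ∀ j, j ≠ i → y j = 0) : ∏ j, (1 - y j) = 1 - y i := by
  rw [Finset.prod_eq_single i]
  · intro j _ hj
    rw [hy j hj, sub_zero]
  · simp

/-! ### The framework theorem -/

/-- The profile in which, in state `k`, player `q k` quits with probability `δ`. -/
def chainStrat {K : Type} {N : ℕ} (f0 : ℝ → K) (F : K → ℝ → K) (q : K → Fin N) (δ : ℝ) :
    Fin N → SunspotStrategy :=
  fun i t s => if q (chainState f0 F t s) = i then δ else 0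

lemma tendsto_alive {K : Type} [Fintype K] [MeasurableSpace K] [DiscreteMeasurableSpace K]
    (f0 : ℝ → K) (F : K → ℝ → K) (hf0 : Measurable f0) (hF : ∀ k, Measurable (F k))
    (P : K → K → ℝ) (hPs : ∀ k, ∑ m, P k m = 1)
    (hP : ∀ k (H : K → ℝ), ∫ s, H (F k s) ∂((volume : Measure ℝ).restrict (Set.Icc 0 1))
      = ∑ m, P k m * H m)
    {N : ℕ} (q : K → Fin N) (δ η : ℝ) (hδ0 : 0 < δ) (hδ1 : δ < 1) (hη0 : 0 < η) (hη1 : η ≤ 1)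
    (i : Fin N) (hterm : ∀ k, η ≤ ∑ m, P k m * (if q m = i then 0 else 1))
    (ζ : Fin N → SunspotStrategy) (hζ : ∀ i, ValidSunspotStrategy (ζ i))
    (hζi : ∀ j, j ≠ i → ζ j = chainStrat f0 F q δ j) :
    Filter.Tendsto (aliveE ζ) Filter.atTop (nhds 0) := by
  have hstep : ∀ t, aliveE ζ (t + 2) ≤ (1 - δ * η) * aliveE ζ (t + 1) := by
    intro t
    set H : K → ℝ := fun k => 1 - δ * (if q k = i then 0 else 1) with hH
    have hHb : ∀ k, |H k| ≤ 1 := by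
      intro k
      simp only [hH]
      rw [abs_le]
      split_ifs <;> constructor <;> linarith
    have hcont : ∀ s, contP ζ (t + 1) s ≤ H (chainState f0 F (t + 1) s) := by
      intro s
      by_cases hq : q (chainState f0 F (t + 1) s) = i
      · simp only [hH, hq, if_true, mul_zero, sub_zero]
        exact (contP_mem ζ hζ _ s).2
      · simp only [hH, hq, if_false, mul_one]
        rw [contP, ← Finset.mul_prod_erase _ _ (Finset.mem_univ (q (chainState f0 F (t + 1) s)))]
        have h1 : ζ (q (chainState f0 F (t + 1) s)) (t + 1) s = δ := by
          rw [hζi _ hq, chainStrat]; simp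
        rw [h1]
        refine mul_le_of_le_one_right (by linarith) ?_
        exact Finset.prod_le_one (fun j _ => by linarith [((hζ j (t + 1)).2 s).2])
          fun j _ => by linarith [((hζ j (t + 1)).2 s).1]
    rw [aliveE_succ ζ hζ (t + 1), aliveE_succ ζ hζ t]
    have hmA : Measurable fun s => aliveP ζ t s * contP ζ t s :=
      (measurable_aliveP ζ hζ t).mul (measurable_contP ζ hζ t)
    have hle : ∫ s, aliveP ζ (t + 1) s * contP ζ (t + 1) s ∂(signalMeasure (t + 1 + 1)) ≤
        ∫ s, aliveP ζ (t + 1) s * H (chainState f0 F (t + 1) s)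
          ∂(signalMeasure (t + 1 + 1)) := by
      refine integral_mono (integrable_alive_cont ζ hζ (t + 1)) ?_ fun s =>
        mul_le_mul_of_nonneg_left (hcont s) (aliveP_mem ζ hζ _ s).1
      refine (integrable_alive ζ hζ (t + 1)).mul_bdd (c := 1) ?_
        (Filter.Eventually.of_forall fun s => hHb _)
      exact ((measurable_of_countable H).comp
        (measurable_chainState f0 F hf0 hF (t + 1))).aestronglyMeasurable
    refine hle.trans ?_
    simp only [aliveP_succ]
    rw [integral_chain_succ f0 F hf0 hF P hP t (fun s => aliveP ζ t s * contP ζ t s) hmA 1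
      (alive_cont_bound ζ hζ t) H, ← integral_const_mul]
    have hPH : ∀ k, ∑ m, P k m * H m ≤ 1 - δ * η := by
      intro k
      have : ∑ m, P k m * H m = 1 - δ * ∑ m, P k m * (if q m = i then 0 else 1) := by
        have e : ∑ m, P k m * H m =
            ∑ m, P k m - δ * ∑ m, P k m * (if q m = i then 0 else 1) := by
          rw [Finset.mul_sum, ← Finset.sum_sub_distrib]
          refine Finset.sum_congr rfl fun m _ => ?_
          simp only [hH]; ring
        rw [e, hPs k]
      rw [this]
      have := mul_le_mul_of_nonneg_left (hterm k) hδ0.le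
      linarith
    refine integral_mono ?_ ((integrable_alive_cont ζ hζ t).const_mul _) fun s => ?_
    · refine (integrable_alive_cont ζ hζ t).mul_bdd
        (c := ∑ k, |∑ m, P k m * H m|) ?_ (Filter.Eventually.of_forall fun s =>
          Finset.single_le_sum (f := fun k => |∑ m, P k m * H m|)
            (fun k _ => abs_nonneg _) (Finset.mem_univ _))
      exact ((measurable_of_countable fun k => ∑ m, P k m * H m).comp
        (measurable_chainState f0 F hf0 hF t)).aestronglyMeasurable
    · have h1 : 0 ≤ aliveP ζ t s * contP ζ t s :=
        mul_nonneg (aliveP_mem ζ hζ t s).1 (contP_mem ζ hζ t s).1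
      have := mul_le_mul_of_nonneg_left (hPH (chainState f0 F t s)) h1
      simp only
      linarith
  have hc0 : 0 ≤ 1 - δ * η := by nlinarith
  have hc1 : 1 - δ * η < 1 := by nlinarith
  have hgeo : ∀ t, aliveE ζ (t + 1) ≤ (1 - δ * η) ^ t * aliveE ζ 1 := by
    intro t
    induction t with
    | zero => simp
    | succ t ih =>
      refine (hstep t).trans ?_
      rw [pow_succ]
      have := mul_le_mul_of_nonneg_left ih hc0
      linarith
  rw [← Filter.tendsto_add_atTop_iff_nat 1]
  refine squeeze_zero (fun t => aliveE_nonneg ζ hζ _) hgeo ?_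
  simpa using (tendsto_pow_atTop_nhds_zero_of_lt_one hc0 hc1).mul_const (aliveE ζ 1)

theorem framework {K : Type} [Fintype K] {N : ℕ}
    (r : Finset (Fin N) → Fin N → ℝ) (hr : ∀ S i, r S i ∈ Set.Icc (-1 : ℝ) 1)
    (hdiag : ∀ i : Fin N, r {i} i = 0)
    (P : K → K → ℝ) (hPn : ∀ k m, 0 ≤ P k m) (hPs : ∀ k, ∑ m, P k m = 1)
    (p0 : K → ℝ) (hp0n : ∀ m, 0 ≤ p0 m) (hp0s : ∑ m, p0 m = 1)
    (q : K → Fin N) (δ η : ℝ) (hδ0 : 0 < δ) (hδ1 : δ < 1) (hη0 : 0 < η) (hη1 : η ≤ 1)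
    (hterm : ∀ i k, η ≤ ∑ m, P k m * (if q m = i then 0 else 1))
    (U L : Fin N → K → ℝ) (hU0 : ∀ i k, 0 ≤ U i k)
    (hU1 : ∀ i k, q k = i → ∑ m, P k m * U i m ≤ U i k)
    (hU2 : ∀ i k, q k ≠ i → δ * r {q k} i + (1 - δ) * ∑ m, P k m * U i m ≤ U i k)
    (hL : ∀ i k, L i k ≤ δ * r {q k} i + (1 - δ) * ∑ m, P k m * L i m) :
    ∃ ξ : Fin N → SunspotStrategy, (∀ i, ValidSunspotStrategy (ξ i)) ∧
      (∀ i, ∑ m, p0 m * L i m ≤ sunspotPayoff r ξ i) ∧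
      ∀ i ξ', ValidSunspotStrategy ξ' →
        sunspotPayoff r (Function.update ξ i ξ') i ≤ ∑ m, p0 m * U i m + δ := by
  classical
  let _ : MeasurableSpace K := ⊤
  have _ : DiscreteMeasurableSpace K := ⟨fun _ => trivial⟩
  obtain ⟨f0, hf0, hf0i⟩ := exists_signal_map p0 hp0n hp0s
  choose F hF hFi using fun k => exists_signal_map (P k) (hPn k) (hPs k)
  set ξ := chainStrat f0 F q δ with hξ
  have hval : ∀ i, ValidSunspotStrategy (ξ i) := by
    intro i t
    constructor
    · exact (measurable_of_countable fun k => if q k = i then δ else 0).comp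
        (measurable_chainState f0 F hf0 hF t)
    · intro s
      simp only [hξ, chainStrat]
      split_ifs
      · exact ⟨hδ0.le, hδ1.le⟩
      · exact ⟨le_rfl, zero_le_one⟩
  have hρ : ∀ i S, |r S i| ≤ 1 := fun i S => abs_le.mpr (hr S i)
  refine ⟨ξ, hval, fun i => ?_, fun i ξ' hξ' => ?_⟩
  · have h0 := tendsto_alive f0 F hf0 hF P hPs hFi q δ η hδ0 hδ1 hη0 hη1 i (hterm i) ξ hval
      (fun _ _ => rfl)
    have h := drift_bound f0 F hf0 hF P hFi p0 hf0i ξ hval h0 (fun S => - r S i) 1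
      (fun S => by rw [abs_neg]; exact hρ i S) (fun k => - L i k) ?_
    · rw [payoff_eq ξ hval h0]
      have e1 : stageG ξ (fun S => - r S i) = fun t => - stageG ξ (fun S => r S i) t := by
        funext t; simp [stageG]
      rw [e1, tsum_neg] at h
      simp only [mul_neg, Finset.sum_neg_distrib] at h
      linarith
    · intro t s
      set k := chainState f0 F t s with hk
      have hy : ∀ j, j ≠ q k → (fun j => ξ j t s) j = 0 := by
        intro j hj
        simp only [hξ, chainStrat, ← hk]
        rw [if_neg (Ne.symm hj)]
      have hyq : ξ (q k) t s = δ := by simp only [hξ, chainStrat, ← hk, if_true]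
      rw [stage_one _ (q k) hy, contP, cont_one (fun j => ξ j t s) (q k) hy, hyq]
      have := hL i k
      simp only [mul_neg, Finset.sum_neg_distrib]
      linarith
  · set ζ := Function.update ξ i ξ' with hζd
    have hζi : ∀ j, j ≠ i → ζ j = ξ j := fun j hj => Function.update_of_ne hj _ _
    have hζ : ∀ j, ValidSunspotStrategy (ζ j) := by
      intro j
      by_cases hj : j = i
      · subst hj; rw [hζd, Function.update_self]; exact hξ'
      · rw [hζi j hj]; exact hval j
    have h0 := tendsto_alive f0 F hf0 hF P hPs hFi q δ η hδ0 hδ1 hη0 hη1 i (hterm i) ζ hζ hζi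
    have h := drift_bound f0 F hf0 hF P hFi p0 hf0i ζ hζ h0 (fun S => r S i - δ) (1 + δ)
      (fun S => (abs_sub _ _).trans (by rw [abs_of_pos hδ0]; linarith [hρ i S])) (U i) ?_
    · rw [payoff_eq ζ hζ h0]
      have e1 : stageG ζ (fun S => r S i - δ) =
          fun t => stageG ζ (fun S => r S i) t - δ * stageG ζ (fun _ => 1) t := by
        funext t
        simp only [stageG, Finset.mul_sum, ← Finset.sum_sub_distrib]
        refine Finset.sum_congr rfl fun S _ => by ring
      rw [e1, (summable_stageG ζ hζ h0 _ 1 (hρ i)).tsum_sub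
        ((hasSum_stageG_one ζ hζ h0).summable.mul_left δ), tsum_mul_left,
        (hasSum_stageG_one ζ hζ h0).tsum_eq] at h
      linarith
    · intro t s
      set k := chainState f0 F t s with hk
      have hyi := (hζ i t).2 s
      have hy : ∀ j, j ≠ i → j ≠ q k → (fun j => ζ j t s) j = 0 := by
        intro j hj hjq
        simp only [hζi j hj]
        simp only [hξ, chainStrat, ← hk]
        rw [if_neg (Ne.symm hjq)]
      by_cases hq : q k = i
      · have hy1 : ∀ j, j ≠ i → (fun j => ζ j t s) j = 0 := fun j hj =>
          hy j hj (by rw [hq]; exact hj)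
        rw [stage_one _ i hy1, contP, cont_one (fun j => ζ j t s) i hy1, hdiag]
        have h1 := hU1 i k hq
        have h2 := hU0 i k
        have h3 := mul_le_mul_of_nonneg_left h1 (sub_nonneg.mpr hyi.2)
        have h4 := mul_nonneg hyi.1 h2
        have h5 := mul_nonneg hyi.1 hδ0.le
        linarith
      · have hyq : ζ (q k) t s = δ := by
          rw [hζi _ hq]
          simp only [hξ, chainStrat, ← hk, if_true]
        rw [stage_two _ i (q k) (Ne.symm hq) hy, contP,
          cont_two (fun j => ζ j t s) i (q k) (Ne.symm hq) hy, hdiag]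
        simp only [hyq]
        have h1 := hU2 i k hq
        have h2 := hU0 i k
        have h3 := mul_le_mul_of_nonneg_left h1 (sub_nonneg.mpr hyi.2)
        have h4 := mul_nonneg hyi.1 h2
        have h5 := mul_nonneg hyi.1 hδ0.le
        have h6 := (hr {i, q k} i).2
        have h7 := mul_le_mul_of_nonneg_left h6 h5
        have h8 := mul_nonneg (mul_nonneg (sub_nonneg.mpr hyi.2) hδ0.le) hδ0.le
        linarith

/-! ### Assembling the chain with threats -/

theorem core {J : Type} [Fintype J] {N : ℕ}
    (r : Finset (Fin N) → Fin N → ℝ) (hr : ∀ S i, r S i ∈ Set.Icc (-1 : ℝ) 1)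
    (hdiag : ∀ i : Fin N, r {i} i = 0)
    (qj thr : J → Fin N) (hthr : ∀ j, thr j ≠ qj j) (hthr0 : ∀ j, r {thr j} (qj j) ≤ 0)
    (P : J → J → ℝ) (hPn : ∀ k m, 0 ≤ P k m) (hPs : ∀ k, ∑ m, P k m = 1)
    (p0 : J → ℝ) (hp0n : ∀ m, 0 ≤ p0 m) (hp0s : ∑ m, p0 m = 1)
    (δ η : ℝ) (hδ0 : 0 < δ) (hδ1 : δ < 1) (hη0 : 0 < η) (hη1 : η ≤ 1 / 2)
    (V : J → Fin N → ℝ) (hV0 : ∀ j i, 0 ≤ V j i) (hV2 : ∀ j i, V j i ≤ 2)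
    (hV1 : ∀ j i, δ * r {qj j} i + (1 - δ) * ∑ l, P j l * V l i ≤ V j i)
    (hV3 : ∀ j i, V j i ≤ δ * (r {qj j} i + η) + (1 - δ) * ∑ l, P j l * V l i)
    (hVo : ∀ j, ∑ l, P j l * V l (qj j) ≤ 0) :
    ∃ ξ : Fin N → SunspotStrategy, (∀ i, ValidSunspotStrategy (ξ i)) ∧
      (∀ i, ∑ m, p0 m * V m i - 13 * η ≤ sunspotPayoff r ξ i) ∧
      ∀ i ξ', ValidSunspotStrategy ξ' →
        sunspotPayoff r (Function.update ξ i ξ') i ≤ ∑ m, p0 m * V m i + 2 * η + δ := by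
  classical
  set w : Bool → ℝ := fun b => if b then η else 1 - η with hw
  set PP : J × Bool → J × Bool → ℝ := fun k m =>
    (if k.2 then (if m.1 = k.1 then 1 else 0) else P k.1 m.1) * w m.2 with hPP
  have hsumF : ∀ (j : J) (H : J × Bool → ℝ), ∑ m, PP (j, false) m * H m =
      ∑ l, P j l * ((1 - η) * H (l, false) + η * H (l, true)) := by
    intro j H
    rw [Fintype.sum_prod_type]
    refine Finset.sum_congr rfl fun l _ => ?_
    simp [hPP, hw]
    ring
  have hsumT : ∀ (j : J) (H : J × Bool → ℝ), ∑ m, PP (j, true) m * H m =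
      (1 - η) * H (j, false) + η * H (j, true) := by
    intro j H
    rw [Fintype.sum_prod_type, Finset.sum_eq_single j]
    · simp [hPP, hw]
      ring
    · intro l _ hl
      simp [hPP, hl]
    · simp
  have hsum0 : ∀ (H : J × Bool → ℝ), ∑ m : J × Bool, (p0 m.1 * w m.2) * H m =
      ∑ l, p0 l * ((1 - η) * H (l, false) + η * H (l, true)) := by
    intro H
    rw [Fintype.sum_prod_type]
    refine Finset.sum_congr rfl fun l _ => ?_
    simp [hw]
    ring
  have hw0 : ∀ b, 0 ≤ w b := by
    intro b; cases b <;> simp [hw] <;> linarith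
  set q : J × Bool → Fin N := fun k => if k.2 then thr k.1 else qj k.1 with hq
  set U : Fin N → J × Bool → ℝ := fun i k =>
    if qj k.1 = i then V k.1 i + 2 * η else
      if k.2 then V k.1 i + 2 * η + δ else V k.1 i + (1 - δ) * (2 * η) with hU
  set L : Fin N → J × Bool → ℝ := fun i k =>
    if k.2 then V k.1 i - 7 * η - 6 * δ else V k.1 i - 7 * η with hL
  have hUm : ∀ i l, (1 - η) * U i (l, false) + η * U i (l, true) ≤ V l i + 2 * η := by
    intro i l
    simp only [hU]
    by_cases h : qj l = i
    · simp [h]; linarith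
    · simp [h]
      nlinarith [mul_pos hη0 hδ0]
  have hLm : ∀ i l, (1 - η) * L i (l, false) + η * L i (l, true) =
      V l i - 7 * η - 6 * δ * η := by
    intro i l
    simp only [hL]
    simp
    ring
  have havg : ∀ (i : Fin N) (p : J → ℝ), (∀ l, 0 ≤ p l) → ∑ l, p l = 1 →
      ∑ l, p l * ((1 - η) * U i (l, false) + η * U i (l, true)) ≤
        ∑ l, p l * V l i + 2 * η := by
    intro i p hp hps
    have : ∑ l, p l * V l i + 2 * η = ∑ l, p l * (V l i + 2 * η) := by
      simp only [mul_add, Finset.sum_add_distrib, ← Finset.sum_mul, hps, one_mul]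
    rw [this]
    exact Finset.sum_le_sum fun l _ => mul_le_mul_of_nonneg_left (hUm i l) (hp l)
  have havgL : ∀ (i : Fin N) (p : J → ℝ), ∑ l, p l = 1 →
      ∑ l, p l * ((1 - η) * L i (l, false) + η * L i (l, true)) =
        ∑ l, p l * V l i - 7 * η - 6 * δ * η := by
    intro i p hps
    simp only [hLm]
    simp only [mul_sub, Finset.sum_sub_distrib, ← Finset.sum_mul, hps, one_mul]
  have hU0 : ∀ i k, 0 ≤ U i k := by
    intro i k
    have := hV0 k.1 i
    have h1 : 0 ≤ (1 - δ) * (2 * η) := by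
      apply mul_nonneg <;> linarith
    simp only [hU]
    split_ifs <;> linarith
  have hfw := framework r hr hdiag PP ?_ ?_ (fun m : J × Bool => p0 m.1 * w m.2)
    ?_ ?_ q δ η hδ0 hδ1 hη0 (by linarith) ?_ U L hU0 ?_ ?_ ?_
  · obtain ⟨ξ, h1, h2, h3⟩ := hfw
    refine ⟨ξ, h1, fun i => ?_, fun i ξ' hξ' => ?_⟩
    · have := h2 i
      rw [hsum0, havgL i p0 hp0s] at this
      nlinarith
    · have := h3 i ξ' hξ'
      rw [hsum0] at this
      linarith [havg i p0 hp0n hp0s]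
  · intro k m
    refine mul_nonneg ?_ (hw0 _)
    split_ifs
    · exact zero_le_one
    · exact le_rfl
    · exact hPn _ _
  · rintro ⟨j, b⟩
    cases b
    · have := hsumF j (fun _ => 1)
      simp only [mul_one, sub_add_cancel] at this
      rw [this, hPs]
    · have := hsumT j (fun _ => 1)
      simp only [mul_one, sub_add_cancel] at this
      exact this
  · intro m
    exact mul_nonneg (hp0n _) (hw0 _)
  · have := hsum0 (fun _ => 1)
    simp only [mul_one, sub_add_cancel] at this
    rw [this, hp0s]
  · rintro i ⟨j, b⟩
    have hone : ∀ l, η ≤ (1 - η) * (if q (l, false) = i then 0 else 1) +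
        η * (if q (l, true) = i then 0 else 1) := by
      intro l
      simp only [hq]
      have := hthr l
      by_cases h1 : qj l = i
      · have h2 : thr l ≠ i := by rw [← h1]; exact this
        simp [h1, h2]
      · simp only [Bool.false_eq_true, if_false, h1, if_true, mul_one]
        split_ifs <;> linarith
    cases b
    · rw [hsumF]
      calc η = ∑ l, P j l * η := by rw [← Finset.sum_mul, hPs, one_mul]
        _ ≤ _ := Finset.sum_le_sum fun l _ => mul_le_mul_of_nonneg_left (hone l) (hPn j l)
    · rw [hsumT]
      exact hone j
  · rintro i ⟨j, b⟩ hqi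
    cases b
    · simp only [hq, Bool.false_eq_true, if_false] at hqi
      rw [hsumF]
      have h1 := havg i (P j) (hPn j) (hPs j)
      have h2 := hVo j
      rw [hqi] at h2
      have h3 : U i (j, false) = V j i + 2 * η := by simp [hU, hqi]
      have := hV0 j i
      linarith
    · simp only [hq, if_true] at hqi
      rw [hsumT]
      have h1 := hUm i j
      have h4 : qj j ≠ i := by rw [← hqi]; exact (hthr j).symm
      have h3 : U i (j, true) = V j i + 2 * η + δ := by simp [hU, h4]
      linarith
  · rintro i ⟨j, b⟩ hqi
    cases b
    · simp only [hq, Bool.false_eq_true, if_false] at hqi ⊢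
      rw [hsumF]
      have h1 := havg i (P j) (hPn j) (hPs j)
      have h2 := mul_le_mul_of_nonneg_left h1 (show 0 ≤ 1 - δ by linarith)
      have h3 : U i (j, false) = V j i + (1 - δ) * (2 * η) := by simp [hU, hqi]
      have := hV1 j i
      linarith
    · simp only [hq, if_true] at hqi ⊢
      rw [hsumT]
      have h1 := hUm i j
      have h2 := mul_le_mul_of_nonneg_left h1 (show 0 ≤ 1 - δ by linarith)
      have hV := hV0 j i
      have h5 : 0 ≤ δ * (V j i + 2 * η) := mul_nonneg hδ0.le (by linarith)
      by_cases h4 : qj j = i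
      · have h3 : U i (j, true) = V j i + 2 * η := by simp [hU, h4]
        have h6 := hthr0 j
        rw [h4] at h6
        have h7 := mul_le_mul_of_nonneg_left h6 hδ0.le
        linarith
      · have h3 : U i (j, true) = V j i + 2 * η + δ := by simp [hU, h4]
        have h7 := mul_le_mul_of_nonneg_left (hr {thr j} i).2 hδ0.le
        linarith
  · rintro i ⟨j, b⟩
    cases b
    · simp only [hq, Bool.false_eq_true, if_false]
      rw [hsumF, havgL i (P j) (hPs j)]
      have h3 : L i (j, false) = V j i - 7 * η := by simp [hL]
      rw [h3]
      have h4 := hV3 j i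
      nlinarith [mul_pos (mul_pos hδ0 hδ0) hη0]
    · simp only [hq, if_true]
      rw [hsumT, hLm]
      have h3 : L i (j, true) = V j i - 7 * η - 6 * δ := by simp [hL]
      rw [h3]
      have h4 := mul_le_mul_of_nonneg_left (hr {thr j} i).1 hδ0.le
      have h5 := mul_le_mul_of_nonneg_left (hV2 j i) hδ0.le
      nlinarith [mul_pos (mul_pos hδ0 hδ0) hη0, mul_pos hδ0 hη0]

/-! ### Matrices with nonpositive off-diagonal entries -/

lemma zmat_nonneg {J : Type} [Fintype J] [DecidableEq J] (B : Matrix J J ℝ)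
    (hoff : ∀ l j, l ≠ j → B l j ≤ 0) (z : J → ℝ) (hz : ∀ j, 0 < z j)
    (hBz : ∀ l, 0 < (B.mulVec z) l) (y : J → ℝ) (hy : ∀ l, 0 ≤ (B.mulVec y) l) (j : J) :
    0 ≤ y j := by
  obtain ⟨j0, -, hj0⟩ := Finset.exists_min_image Finset.univ (fun j => y j / z j)
    ⟨j, Finset.mem_univ j⟩
  by_contra hneg
  push Not at hneg
  set c := y j0 / z j0 with hc
  have hc0 : c < 0 := (hj0 j (Finset.mem_univ j)).trans_lt (div_neg_of_neg_of_pos hneg (hz j))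
  have hv : ∀ l, 0 ≤ y l - c * z l := by
    intro l
    have := hj0 l (Finset.mem_univ l)
    rw [le_div_iff₀ (hz l)] at this
    linarith
  have hv0 : y j0 - c * z j0 = 0 := by
    rw [hc, div_mul_cancel₀ _ (hz j0).ne', sub_self]
  have h1 : (B.mulVec y) j0 - c * (B.mulVec z) j0 = ∑ l, B j0 l * (y l - c * z l) := by
    simp only [Matrix.mulVec, dotProduct, Finset.mul_sum, ← Finset.sum_sub_distrib]
    exact Finset.sum_congr rfl fun l _ => by ring
  have h2 : ∑ l, B j0 l * (y l - c * z l) ≤ 0 := by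
    refine Finset.sum_nonpos fun l _ => ?_
    by_cases h : j0 = l
    · rw [← h, hv0, mul_zero]
    · exact mul_nonpos_of_nonpos_of_nonneg (hoff _ _ h) (hv l)
  nlinarith [hy j0, hBz j0]

lemma zmat_vertices {J : Type} [Fintype J] [DecidableEq J] (B : Matrix J J ℝ)
    (hoff : ∀ l j, l ≠ j → B l j ≤ 0) (z : J → ℝ) (hz : ∀ j, 0 < z j)
    (hBz : ∀ l, 0 < (B.mulVec z) l) :
    ∃ (c : J → ℝ) (u : J → J → ℝ), (∀ k, 0 < c k) ∧ (∀ k j, 0 ≤ u k j) ∧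
      (∀ k, ∑ j, u k j = 1) ∧ (∀ k l, (B.mulVec (u k)) l = if l = k then c k else 0) ∧
      ∀ (y : J → ℝ) (j : J), y j = ∑ k, (B.mulVec y) k / c k * u k j := by
  have hinj : Function.Injective B.mulVec := by
    intro a b hab
    have h0 : B.mulVec (a - b) = 0 := by rw [Matrix.mulVec_sub, hab, sub_self]
    have h0' : B.mulVec (b - a) = 0 := by rw [Matrix.mulVec_sub, hab, sub_self]
    funext j
    have h1 := zmat_nonneg B hoff z hz hBz (a - b) (fun l => by rw [h0]; simp) j
    have h2 := zmat_nonneg B hoff z hz hBz (b - a) (fun l => by rw [h0']; simp) j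
    simp at h1 h2
    linarith
  have hsurj : Function.Surjective B.mulVec :=
    Matrix.mulVec_surjective_iff_isUnit.mpr (Matrix.mulVec_injective_iff_isUnit.mp hinj)
  choose v hv using fun k => hsurj (Pi.single k 1)
  have hv0 : ∀ k j, 0 ≤ v k j := fun k j => zmat_nonneg B hoff z hz hBz (v k) (fun l => by
    rw [hv k, Pi.single_apply]; split_ifs <;> simp) j
  have hs : ∀ k, 0 < ∑ j, v k j := by
    intro k
    refine lt_of_le_of_ne (Finset.sum_nonneg fun j _ => hv0 k j) fun h => ?_
    have h1 := (Finset.sum_eq_zero_iff_of_nonneg (fun j _ => hv0 k j)).mp h.symm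
    have h2 : v k = 0 := funext fun j => h1 j (Finset.mem_univ j)
    have h3 := congrFun (hv k) k
    rw [h2] at h3
    simp at h3
  refine ⟨fun k => (∑ j, v k j)⁻¹, fun k j => (∑ j, v k j)⁻¹ * v k j, fun k => inv_pos.mpr (hs k),
    fun k j => mul_nonneg (inv_pos.mpr (hs k)).le (hv0 k j), fun k => ?_, fun k l => ?_,
    fun y j => ?_⟩
  · rw [← Finset.mul_sum, inv_mul_cancel₀ (hs k).ne']
  · have : (fun j => (∑ j, v k j)⁻¹ * v k j) = (∑ j, v k j)⁻¹ • v k := rfl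
    change B.mulVec (fun j => (∑ j, v k j)⁻¹ * v k j) l = _
    rw [this, Matrix.mulVec_smul, hv k]
    simp [Pi.single_apply]
  · have h : y = ∑ k, (B.mulVec y) k • v k := by
      apply hinj
      rw [Matrix.mulVec_sum]
      simp_rw [Matrix.mulVec_smul, hv]
      funext l
      simp [Finset.sum_apply, Pi.single_apply]
    conv_lhs => rw [h]
    rw [Finset.sum_apply]
    refine Finset.sum_congr rfl fun k _ => ?_
    have := (hs k).ne'
    simp only [Pi.smul_apply, smul_eq_mul]
    field_simp

/-! ### Combinatorics of normal players -/

lemma exists_weights {n N : ℕ} (g : Fin n → Fin N → ℝ) (x : Fin N → ℝ)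
    (hx : x ∈ convexHull ℝ (Set.range g)) :
    ∃ z : Fin n → ℝ, (∀ j, 0 ≤ z j) ∧ ∑ j, z j = 1 ∧ ∀ i, x i = ∑ j, z j * g j i := by
  have h : convexHull ℝ (Set.range g) ⊆
      {x | ∃ z : Fin n → ℝ, (∀ j, 0 ≤ z j) ∧ ∑ j, z j = 1 ∧ ∀ i, x i = ∑ j, z j * g j i} := by
    refine convexHull_min ?_ ?_
    · rintro _ ⟨j, rfl⟩
      refine ⟨Pi.single j 1, fun k => ?_, ?_, fun i => ?_⟩
      · rw [Pi.single_apply]; split_ifs <;> simp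
      · simp
      · simp [Pi.single_apply]
    · rintro x ⟨z, hz, hzs, hzx⟩ y ⟨w, hw, hws, hwy⟩ a b ha hb hab
      refine ⟨fun j => a * z j + b * w j, fun j => ?_, ?_, fun i => ?_⟩
      · exact add_nonneg (mul_nonneg ha (hz j)) (mul_nonneg hb (hw j))
      · rw [Finset.sum_add_distrib, ← Finset.mul_sum, ← Finset.mul_sum, hzs, hws]
        linarith
      · simp only [Pi.add_apply, Pi.smul_apply, smul_eq_mul, hzx, hwy, Finset.mul_sum,
          ← Finset.sum_add_distrib]
        exact Finset.sum_congr rfl fun j _ => by ring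
  exact h hx

lemma exists_threat {N : ℕ} (r : Finset (Fin N) → Fin N → ℝ) (i : Fin N)
    (hi : i ∈ normalPlayers r) : ∃ j, j ≠ i ∧ r {j} i ≤ 0 := by
  have h := Set.mem_iInter.mp hi 1
  obtain ⟨-, j, -, hj, hj'⟩ := h
  exact ⟨j, hj, hj'⟩

lemma pos_of_not_normal {N : ℕ} (r : Finset (Fin N) → Fin N → ℝ) (i j : Fin N)
    (hi : i ∉ normalPlayers r) (hj : j ∈ normalPlayers r) : 0 < r {j} i := by
  by_contra hneg
  push Not at hneg
  apply hi
  refine Set.mem_iInter.mpr fun l => ?_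
  induction l with
  | zero => trivial
  | succ l ih =>
    refine ⟨ih, j, Set.mem_iInter.mp hj l, ?_, hneg⟩
    rintro rfl
    exact hi hj

/-- **If the set of normal players is `{0,…,n-1}` and the matrix `R̂` is an `M`-matrix,
then every payoff vector in `D̃ = conv{r^1,…,r^n} ∩ ℝ^N_{≥0}` is a sunspot equilibrium
payoff: for every `x ∈ D̃` and every `ε > 0` there is a sunspot `ε`-equilibrium whose
payoff is within `ε` of `x` in every coordinate.** -/
theorem sunspot_equilibrium_payoffs_of_MMatrix
    (N n : ℕ) (hN : 1 ≤ N) (hnN : n ≤ N)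
    (r : Finset (Fin N) → Fin N → ℝ)
    (hr : ∀ S i, r S i ∈ Set.Icc (-1 : ℝ) 1)
    (hdiag : ∀ i : Fin N, r {i} i = 0)
    (hIstar : normalPlayers r = {i : Fin N | (i : ℕ) < n})
    (hM : IsMMatrix n (fun i j => r {Fin.castLE hnN i} (Fin.castLE hnN j)))
    (x : Fin N → ℝ)
    (hx : x ∈ convexHull ℝ (Set.range fun i : Fin n => r {Fin.castLE hnN i}) ∩
        {v : Fin N → ℝ | ∀ j, 0 ≤ v j})
    (ε : ℝ) (hε : 0 < ε) :
    ∃ ξ : Fin N → SunspotStrategy,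
      IsSunspotEpsEquilibrium r ξ ε ∧
        ∀ i : Fin N, |sunspotPayoff r ξ i - x i| ≤ ε := by
  classical
  obtain ⟨hxc, hx0⟩ := hx
  obtain ⟨z, hz0, hzs, hzx⟩ := exists_weights _ x hxc
  obtain ⟨-, hrow, hcol⟩ := hM
  set c : Fin n → Fin N := Fin.castLE hnN with hcdef
  have hcinj : Function.Injective c := Fin.castLE_injective hnN
  have hcn : ∀ j, c j ∈ normalPlayers r := by
    intro j; rw [hIstar]; exact j.2
  choose π hπ hπu using hcol
  simp only at hπ hπu
  have hπinj : Function.Injective π := by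
    intro a b hab
    refine (hrow (π a)).unique (hπ a) ?_
    simp only
    rw [hab]
    exact hπ b
  have hnonpos : ∀ j i, i ≠ π j → r {c j} (c i) ≤ 0 := by
    intro j i hi
    by_contra h
    push Not at h
    exact hi (hπu j i h)
  have hπne : ∀ j, π j ≠ j := by
    intro j h
    have := hπ j
    rw [h, hdiag] at this
    exact lt_irrefl _ this
  choose thr hthr hthr0 using fun j => exists_threat r (c j) (hcn j)
  let J := {j : Fin n // 0 < z j}
  have hJsum : ∀ g : Fin n → ℝ, ∑ j : J, z j.1 * g j.1 = ∑ j, z j * g j := by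
    intro g
    rw [← Finset.sum_subtype (Finset.univ.filter fun j => 0 < z j) (p := fun j => 0 < z j)
      (by simp) (fun j => z j * g j)]
    refine Finset.sum_subset (Finset.subset_univ _) fun j _ hj => ?_
    simp at hj
    rw [le_antisymm hj (hz0 j), zero_mul]
  have hJs : ∑ j : J, z j.1 = 1 := by
    have := hJsum (fun _ => 1)
    simpa [hzs] using this
  have hJx : ∀ i, ∑ j : J, z j.1 * r {c j.1} i = x i := by
    intro i
    rw [hzx i]
    exact hJsum fun j => r {c j} i
  have hJne : Nonempty J := by
    by_contra h
    rw [not_nonempty_iff] at h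
    simp at hJs
  obtain ⟨η, hη0, hη1, hηε⟩ : ∃ η : ℝ, 0 < η ∧ η ≤ 1 / 2 ∧ 16 * η ≤ ε :=
    ⟨min (ε / 16) (1 / 2), lt_min (by linarith) (by norm_num), min_le_right _ _, by
      linarith [min_le_left (ε / 16) (1 / 2)]⟩
  -- perturbed payoffs
  set ρ : J → Fin N → ℝ := fun j i => r {c j.1} i + if i = c (π j.1) then η else 0 with hρ
  have hρ1 : ∀ j i, r {c j.1} i ≤ ρ j i := by
    intro j i; simp only [hρ]; split_ifs <;> linarith
  have hρ2 : ∀ j i, ρ j i ≤ r {c j.1} i + η := by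
    intro j i; simp only [hρ]; split_ifs <;> linarith
  have hρne : ∀ (j : J) i, i ≠ π j.1 → ρ j (c i) = r {c j.1} (c i) := by
    intro j i hi
    simp only [hρ]
    rw [if_neg (fun h => hi (hcinj h)), add_zero]
  set B : Matrix J J ℝ := fun l j => ρ j (c (π l.1)) with hB
  have hoff : ∀ l j, l ≠ j → B l j ≤ 0 := by
    intro l j hlj
    have h1 : π l.1 ≠ π j.1 := fun h => hlj (Subtype.ext (hπinj h))
    simp only [hB]
    rw [hρne j _ h1]
    exact hnonpos j.1 _ h1
  have hBmul : ∀ (y : J → ℝ) l, (B.mulVec y) l = ∑ j, y j * ρ j (c (π l.1)) := by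
    intro y l
    simp only [Matrix.mulVec, dotProduct, hB]
    exact Finset.sum_congr rfl fun j _ => mul_comm _ _
  have hzρ1 : ∀ i, x i ≤ ∑ j : J, z j.1 * ρ j i := by
    intro i
    rw [← hJx i]
    exact Finset.sum_le_sum fun j _ => mul_le_mul_of_nonneg_left (hρ1 j i) (hz0 _)
  have hzρ2 : ∀ i, ∑ j : J, z j.1 * ρ j i ≤ x i + η := by
    intro i
    have : x i + η = ∑ j : J, z j.1 * (r {c j.1} i + η) := by
      simp only [mul_add, Finset.sum_add_distrib, ← Finset.sum_mul, hJs, hJx, one_mul]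
    rw [this]
    exact Finset.sum_le_sum fun j _ => mul_le_mul_of_nonneg_left (hρ2 j i) (hz0 _)
  have hBz : ∀ l, 0 < (B.mulVec (fun j : J => z j.1)) l := by
    intro l
    rw [hBmul]
    have h1 : 0 ≤ ∑ j : J, z j.1 * r {c j.1} (c (π l.1)) := by rw [hJx]; exact hx0 _
    refine h1.trans_lt (Finset.sum_lt_sum (fun j _ =>
      mul_le_mul_of_nonneg_left (hρ1 j _) (hz0 _)) ⟨l, Finset.mem_univ _, ?_⟩)
    refine mul_lt_mul_of_pos_left ?_ l.2
    simp only [hρ, if_true]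
    linarith
  obtain ⟨C, u, hC, hu0, hus, hBu, hdec⟩ :=
    zmat_vertices B hoff (fun j : J => z j.1) (fun j => j.2) hBz
  obtain ⟨δ, hδ0, hδη, hδC⟩ : ∃ δ : ℝ, 0 < δ ∧ δ ≤ η ∧ ∀ k, 2 * δ ≤ C k := by
    obtain ⟨k0, -, hk0⟩ := Finset.exists_min_image Finset.univ C Finset.univ_nonempty
    refine ⟨min η (C k0 / 2), lt_min hη0 (by linarith [hC k0]), min_le_left _ _, fun k => ?_⟩
    have := hk0 k (Finset.mem_univ k)
    linarith [min_le_right η (C k0 / 2)]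
  have hδ1 : δ < 1 := by linarith
  set V : J → Fin N → ℝ := fun k i => ∑ j, u k j * ρ j i with hV
  have hzero : ∀ i, (∀ l : J, π l.1 ≠ i) → ∀ j : J, ρ j (c i) = 0 := by
    intro i hi j
    rw [hρne j i (hi j).symm]
    have h1 : ∀ j ∈ (Finset.univ : Finset J), z j.1 * r {c j.1} (c i) ≤ 0 := fun j _ =>
      mul_nonpos_of_nonneg_of_nonpos (hz0 _) (hnonpos j.1 i (hi j).symm)
    have h2 : ∑ j : J, z j.1 * r {c j.1} (c i) = 0 :=
      le_antisymm (Finset.sum_nonpos h1) (by rw [hJx]; exact hx0 _)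
    have h3 := (Finset.sum_eq_zero_iff_of_nonpos h1).mp h2 j (Finset.mem_univ j)
    exact (mul_eq_zero.mp h3).resolve_left j.2.ne'
  have hVn : ∀ k i, V k (c i) = if i = π k.1 then C k else 0 := by
    intro k i
    by_cases h : ∃ l : J, π l.1 = i
    · obtain ⟨l, rfl⟩ := h
      have h1 := hBu k l
      rw [hBmul] at h1
      simp only [hV]
      rw [h1]
      by_cases hlk : l = k
      · subst hlk; simp
      · rw [if_neg hlk, if_neg fun h => hlk (Subtype.ext (hπinj h))]
    · push Not at h
      rw [if_neg (h k).symm]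
      simp only [hV]
      exact Finset.sum_eq_zero fun j _ => by rw [hzero i h j, mul_zero]
  have hV0 : ∀ k i, 0 ≤ V k i := by
    intro k i
    by_cases hi : i ∈ normalPlayers r
    · have hi' : (i : ℕ) < n := by rw [hIstar] at hi; exact hi
      have : i = c ⟨i, hi'⟩ := rfl
      rw [this, hVn]
      split_ifs
      · exact (hC k).le
      · exact le_rfl
    · exact Finset.sum_nonneg fun j _ => mul_nonneg (hu0 k j)
        ((pos_of_not_normal r i (c j.1) hi (hcn _)).le.trans (hρ1 j i))
  have hV2 : ∀ k i, V k i ≤ 2 := by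
    intro k i
    calc V k i ≤ ∑ j, u k j * 2 := Finset.sum_le_sum fun j _ =>
          mul_le_mul_of_nonneg_left (by linarith [hρ2 j i, (hr {c j.1} i).2]) (hu0 k j)
      _ = 2 := by rw [← Finset.sum_mul, hus, one_mul]
  have hdecV : ∀ (y : J → ℝ) i, ∑ k, (B.mulVec y) k / C k * V k i = ∑ j, y j * ρ j i := by
    intro y i
    simp only [hV, Finset.mul_sum]
    rw [Finset.sum_comm]
    refine Finset.sum_congr rfl fun j _ => ?_
    conv_rhs => rw [hdec y j]
    rw [Finset.sum_mul]
    exact Finset.sum_congr rfl fun k _ => by ring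
  have hdecS : ∀ (y : J → ℝ), ∑ k, (B.mulVec y) k / C k = ∑ j, y j := by
    intro y
    calc ∑ k, (B.mulVec y) k / C k = ∑ k, ∑ j, (B.mulVec y) k / C k * u k j := by
          refine Finset.sum_congr rfl fun k _ => ?_
          rw [← Finset.mul_sum, hus, mul_one]
      _ = ∑ j, y j := by
          rw [Finset.sum_comm]
          exact Finset.sum_congr rfl fun j _ => (hdec y j).symm
  have hδ' : (0:ℝ) < 1 - δ := by linarith
  set Y : J → J → ℝ := fun k j => (u k j - δ * if j = k then 1 else 0) / (1 - δ) with hY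
  have hYsum : ∀ k (g : J → ℝ), ∑ j, Y k j * g j = (∑ j, u k j * g j - δ * g k) / (1 - δ) := by
    intro k g
    have : ∑ j, u k j * g j - δ * g k =
        ∑ j, (u k j - δ * if j = k then 1 else 0) * g j := by
      simp only [sub_mul, Finset.sum_sub_distrib]
      congr 1
      rw [Finset.sum_eq_single k]
      · simp
      · intro b _ hb
        simp [hb]
      · intro h
        exact absurd (Finset.mem_univ k) h
    rw [this, Finset.sum_div]
    refine Finset.sum_congr rfl fun j _ => ?_
    simp only [hY]; ring
  have hYone : ∀ k, ∑ j, Y k j = 1 := by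
    intro k
    have := hYsum k (fun _ => 1)
    simp only [mul_one, hus] at this
    rw [this, div_self hδ'.ne']
  have hPV : ∀ k i, (1 - δ) * ∑ l, (B.mulVec (Y k)) l / C l * V l i = V k i - δ * ρ k i := by
    intro k i
    rw [hdecV, hYsum, mul_div_cancel₀ _ hδ'.ne']
  have hcore := core (J := J) r hr hdiag (fun j => c j.1) (fun j => thr j.1)
    (fun j => hthr j.1) (fun j => hthr0 j.1) (fun k l => (B.mulVec (Y k)) l / C l) ?_ ?_
    (fun l => (B.mulVec (fun j : J => z j.1)) l / C l)
    (fun l => div_nonneg (hBz l).le (hC l).le) ?_ δ η hδ0 hδ1 hη0 hη1 V hV0 hV2 ?_ ?_ ?_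
  · obtain ⟨ξ, h1, h2, h3⟩ := hcore
    have hself : ∀ i, sunspotPayoff r ξ i ≤ x i + η + 2 * η + δ := by
      intro i
      have h4 := h3 i (ξ i) (h1 i)
      rw [Function.update_eq_self, hdecV] at h4
      linarith [hzρ2 i]
    have hlow : ∀ i, ∑ j : J, z j.1 * ρ j i - 13 * η ≤ sunspotPayoff r ξ i := by
      intro i
      have h4 := h2 i
      rwa [hdecV] at h4
    refine ⟨ξ, ⟨h1, fun i ξ' hξ' => ?_⟩, fun i => ?_⟩
    · have h4 := h3 i ξ' hξ'
      rw [hdecV] at h4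
      linarith [hlow i]
    · rw [abs_le]
      constructor
      · linarith [hlow i, hzρ1 i]
      · linarith [hself i]
  · intro k l
    refine div_nonneg ?_ (hC l).le
    rw [hBmul, hYsum, ← hBmul, hBu]
    refine div_nonneg ?_ hδ'.le
    by_cases hlk : l = k
    · subst hlk
      simp only [if_true]
      have h4 : ρ l (c (π l.1)) ≤ 2 := by linarith [hρ2 l (c (π l.1)), (hr {c l.1} (c (π l.1))).2]
      have := mul_le_mul_of_nonneg_left h4 hδ0.le
      linarith [hδC l]
    · rw [if_neg hlk]
      have := mul_nonneg hδ0.le (neg_nonneg.mpr (hoff l k hlk))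
      simp only [hB] at this
      linarith
  · intro k
    rw [hdecS, hYone]
  · rw [hdecS, hJs]
  · intro k i
    rw [hPV]
    have := mul_le_mul_of_nonneg_left (hρ1 k i) hδ0.le
    linarith
  · intro k i
    rw [hPV]
    have := mul_le_mul_of_nonneg_left (hρ2 k i) hδ0.le
    linarith
  · intro k
    have h4 := hPV k (c k.1)
    rw [hVn, if_neg (hπne k.1).symm, hρne k k.1 (hπne k.1).symm, hdiag] at h4
    simp only [mul_zero, sub_zero] at h4
    exact ((mul_eq_zero.mp h4).resolve_left hδ'.ne').le

end
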